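/- Let p be an odd prime and let d = (γc₀ + λm + λ'm' + λ''m'')^π be the code word of C_1(2,p) obtained from the T^odd construction, where π is a collineation of PG(2,p), γ ∈ F_p\{0} and λ, λ', λ'' ∈ F_p. Let S = (m ∩ m' ∩ m'')^π. Then wt(d) = 3p−3 if d(S) = 0, and wt(d) = 3p−2 if d(S) ≠ 0. -/

import Mathlib

open scoped Classical

noncomputable section

namespace PGCode

open Projectivization

/-- The points of `PG(n, q)`, where the field `F` has order `q`. -/
abbrev Pt (F : Type) [Field F] (n : ℕ) := Projectivization F (Fin (n + 1) → F)

variable {F : Type} [Field F]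

/-- A point of `PG(n,q)` lies in the projective subspace determined by a linear subspace `W`. -/
def ptIn {n : ℕ} (P : Pt F n) (W : Submodule F (Fin (n + 1) → F)) : Prop :=
  Projectivization.submodule P ≤ W

/-- The set of points of the projective subspace determined by a linear subspace `W`. -/
def ptsIn {n : ℕ} (W : Submodule F (Fin (n + 1) → F)) : Set (Pt F n) :=
  {P | ptIn P W}

/-- The incidence vector (over `F_p = ZMod p`) of the projective subspace determined by `W`. -/
def incVec (p : ℕ) {n : ℕ} (W : Submodule F (Fin (n + 1) → F)) : Pt F n → ZMod p :=
  fun P => if ptIn P W then (1 : ZMod p) else 0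

/-- The code `C_{n-1}(n,q)`: the `F_p`-span of the incidence vectors of all hyperplanes
(projective dimension `n-1`, i.e. linear dimension `n`). -/
def code (F : Type) [Field F] (p n : ℕ) : Submodule (ZMod p) (Pt F n → ZMod p) :=
  Submodule.span (ZMod p)
    {v | ∃ W : Submodule F (Fin (n + 1) → F), Module.finrank F W = n ∧ v = incVec p W}

/-- The support of a word. -/
def supp {p n : ℕ} (v : Pt F n → ZMod p) : Set (Pt F n) := {P | v P ≠ 0}

/-- The weight of a word. -/
def wt {p n : ℕ} (v : Pt F n → ZMod p) : ℕ := (supp v).ncard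

/-- The weight of the restriction of a word to the subspace determined by `W`. -/
def wtRes {p n : ℕ} (c : Pt F n → ZMod p) (W : Submodule F (Fin (n + 1) → F)) : ℕ :=
  (ptsIn W ∩ supp c).ncard

/-- `θ_m = (q^(m+1) - 1)/(q - 1)`, with `θ_m = 0` for `m < 0`. -/
def theta (q : ℕ) (m : ℤ) : ℕ :=
  if m < 0 then 0 else ∑ i ∈ Finset.range (m.toNat + 1), q ^ i

/-- The bound `B_{n,q}` from the paper. -/
def B (n q : ℕ) : ℝ :=
  if q < 7 ∨ q = 8 ∨ q = 9 ∨ q = 16 ∨ q = 25 ∨ q = 27 ∨ q = 49 then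
    2 * (q : ℝ) ^ (n - 1)
  else if q = 7 ∨ q = 11 ∨ q = 13 ∨ q = 17 then
    (3 * q - Real.sqrt (6 * q) - 1 / 2) * (q : ℝ) ^ (n - 2)
  else if q = 19 ∨ q = 121 then
    (3 * q - Real.sqrt (6 * q) + 9 / 2) * (q : ℝ) ^ (n - 2)
  else if q = 29 ∨ q = 31 ∨ q = 32 then
    (4 * q - 4 * Real.sqrt q - 25 / 2) * (q : ℝ) ^ (n - 2)
  else
    (4 * q - Real.sqrt (8 * q) - 33 / 2) * (q : ℝ) ^ (n - 2)

/-- A line of `PG(n,q)`: a linear subspace of dimension `2`. -/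
def IsLine {n : ℕ} (l : Submodule F (Fin (n + 1) → F)) : Prop := Module.finrank F l = 2

/-- A plane of `PG(n,q)`: a linear subspace of dimension `3`. -/
def IsPlane {n : ℕ} (W : Submodule F (Fin (n + 1) → F)) : Prop := Module.finrank F W = 3

/-- The line `l` is an `α`-secant to `supp c`. -/
def secant {p n : ℕ} (c : Pt F n → ZMod p) (l : Submodule F (Fin (n + 1) → F)) (α : ℕ) : Prop :=
  IsLine l ∧ (ptsIn l ∩ supp c).ncard = α

/-- The restriction of `c` to the plane `W` is a linear combination of at most two lines of `W`. -/
def TwoLineComb (p : ℕ) {n : ℕ} (c : Pt F n → ZMod p) (W : Submodule F (Fin (n + 1) → F)) :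
    Prop :=
  ∃ l₁ l₂ : Submodule F (Fin (n + 1) → F), IsLine l₁ ∧ IsLine l₂ ∧ l₁ ≤ W ∧ l₂ ≤ W ∧
    ∃ a b : ZMod p, ∀ P : Pt F n, ptIn P W → c P = a * incVec p l₁ P + b * incVec p l₂ P

/-- Type `T^△`: the restriction of `c` to the plane `W` is a linear combination (with nonzero
coefficients) of three nonconcurrent lines of `W`. -/
def TypeTri (p : ℕ) {n : ℕ} (c : Pt F n → ZMod p) (W : Submodule F (Fin (n + 1) → F)) : Prop :=
  ∃ l₁ l₂ l₃ : Submodule F (Fin (n + 1) → F),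
    IsLine l₁ ∧ IsLine l₂ ∧ IsLine l₃ ∧ l₁ ≤ W ∧ l₂ ≤ W ∧ l₃ ≤ W ∧
    l₁ ≠ l₂ ∧ l₁ ≠ l₃ ∧ l₂ ≠ l₃ ∧
    (¬ ∃ P : Pt F n, ptIn P l₁ ∧ ptIn P l₂ ∧ ptIn P l₃) ∧
    ∃ a₁ a₂ a₃ : ZMod p, a₁ ≠ 0 ∧ a₂ ≠ 0 ∧ a₃ ≠ 0 ∧
      ∀ P : Pt F n, ptIn P W →
        c P = a₁ * incVec p l₁ P + a₂ * incVec p l₂ P + a₃ * incVec p l₃ P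

/-- Type `T^★`: the restriction of `c` to the plane `W` is a linear combination (with nonzero
coefficients) of three distinct concurrent lines of `W`. -/
def TypeStar (p : ℕ) {n : ℕ} (c : Pt F n → ZMod p) (W : Submodule F (Fin (n + 1) → F)) : Prop :=
  ∃ l₁ l₂ l₃ : Submodule F (Fin (n + 1) → F),
    IsLine l₁ ∧ IsLine l₂ ∧ IsLine l₃ ∧ l₁ ≤ W ∧ l₂ ≤ W ∧ l₃ ≤ W ∧
    l₁ ≠ l₂ ∧ l₁ ≠ l₃ ∧ l₂ ≠ l₃ ∧
    (∃ P : Pt F n, ptIn P l₁ ∧ ptIn P l₂ ∧ ptIn P l₃) ∧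
    ∃ a₁ a₂ a₃ : ZMod p, a₁ ≠ 0 ∧ a₂ ≠ 0 ∧ a₃ ≠ 0 ∧
      ∀ P : Pt F n, ptIn P W →
        c P = a₁ * incVec p l₁ P + a₂ * incVec p l₂ P + a₃ * incVec p l₃ P

/-- The base code word `c₀` of the `T^odd` construction on `PG(2,p)`:
`c₀(0,1,a) = a`, `c₀(1,0,b) = b`, `c₀(1,1,c) = -c`, and `c₀ = 0` elsewhere. -/
def oddBase (p : ℕ) [Fact p.Prime] : Pt (ZMod p) 2 → ZMod p := fun P =>
  if P.rep 0 = 0 ∧ P.rep 1 ≠ 0 then P.rep 2 / P.rep 1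
  else if P.rep 1 = 0 ∧ P.rep 0 ≠ 0 then P.rep 2 / P.rep 0
  else if P.rep 0 = P.rep 1 ∧ P.rep 0 ≠ 0 then -(P.rep 2 / P.rep 0)
  else 0

/-- The line `m : X₀ = 0` of `PG(2,p)`. -/
def lineM1 (p : ℕ) [Fact p.Prime] : Submodule (ZMod p) (Fin 3 → ZMod p) :=
  LinearMap.ker (LinearMap.proj 0 : (Fin 3 → ZMod p) →ₗ[ZMod p] ZMod p)

/-- The line `m' : X₁ = 0` of `PG(2,p)`. -/
def lineM2 (p : ℕ) [Fact p.Prime] : Submodule (ZMod p) (Fin 3 → ZMod p) :=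
  LinearMap.ker (LinearMap.proj 1 : (Fin 3 → ZMod p) →ₗ[ZMod p] ZMod p)

/-- The line `m'' : X₀ = X₁` of `PG(2,p)`. -/
def lineM3 (p : ℕ) [Fact p.Prime] : Submodule (ZMod p) (Fin 3 → ZMod p) :=
  LinearMap.ker ((LinearMap.proj 0 : (Fin 3 → ZMod p) →ₗ[ZMod p] ZMod p) - LinearMap.proj 1)

/-- The code word `d = (γ c₀ + λ m + λ' m' + λ'' m'')^π` of the `T^odd` construction, where the
collineation `π` of `PG(2,p)` is the inverse of the homography induced by the linear
equivalence `g`. -/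
def oddWord (p : ℕ) [Fact p.Prime] (g : (Fin 3 → ZMod p) ≃ₗ[ZMod p] (Fin 3 → ZMod p))
    (γ lam lam' lam'' : ZMod p) : Pt (ZMod p) 2 → ZMod p := fun P =>
  γ * oddBase p (Projectivization.map g.toLinearMap g.injective P) +
    lam * incVec p (lineM1 p) (Projectivization.map g.toLinearMap g.injective P) +
    lam' * incVec p (lineM2 p) (Projectivization.map g.toLinearMap g.injective P) +
    lam'' * incVec p (lineM3 p) (Projectivization.map g.toLinearMap g.injective P)

/-- The semilinear embedding of `PG(2,p)` onto the plane of `PG(n,q)` spanned by the linearly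
independent vectors `b 0, b 1, b 2`, relative to the field embedding `σ : F_p → F`. -/
def planeEmbed {n : ℕ} {p : ℕ} [Fact p.Prime] (σ : ZMod p →+* F)
    (b : Fin 3 → (Fin (n + 1) → F)) (hb : LinearIndependent F b) :
    Pt (ZMod p) 2 → Pt F n := fun P =>
  Projectivization.mk F (∑ i, σ (P.rep i) • b i) (by
    intro hzero
    have h0 : ∀ i ∈ Finset.univ, σ (P.rep i) = 0 :=
      linearIndependent_iff'.mp hb Finset.univ (fun i => σ (P.rep i)) hzero
    have h1 : P.rep = 0 := funext fun i => σ.injective (by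
      simp only [Pi.zero_apply, map_zero]; exact h0 i (Finset.mem_univ i))
    exact P.rep_nonzero h1)

/-- Type `T^odd`: this requires `q = p` to be prime (`|F| = p`), and `c` restricted to the plane
`W` (spanned by the frame `b`) must coincide, via a semilinear identification of `W` with
`PG(2,p)`, with a code word `d` of the `T^odd` construction. -/
def TypeOdd (p : ℕ) [Fact p.Prime] [Fintype F] {n : ℕ} (c : Pt F n → ZMod p)
    (W : Submodule F (Fin (n + 1) → F)) : Prop :=
  Fintype.card F = p ∧
  ∃ (σ : ZMod p →+* F) (b : Fin 3 → (Fin (n + 1) → F)) (hb : LinearIndependent F b),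
    Submodule.span F (Set.range b) = W ∧
    ∃ (g : (Fin 3 → ZMod p) ≃ₗ[ZMod p] (Fin 3 → ZMod p)) (γ lam lam' lam'' : ZMod p), γ ≠ 0 ∧
      ∀ Q : Pt (ZMod p) 2, c (planeEmbed σ b hb Q) = oddWord p g γ lam lam' lam'' Q

/-- The list of plane types `T_0, T_{q+1}, T_{2q}, T_{2q+1}, T^odd, T^△, T^★`. -/
inductive PlaneT : Type where
  | T0 | Tq1 | T2q | T2q1 | Todd | Ttri | Tstar
deriving DecidableEq

/-- The restriction of `c` to the plane `W` is a code word of the given type. -/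
def PlaneIsType (p q : ℕ) [Fact p.Prime] [Fintype F] {n : ℕ} (c : Pt F n → ZMod p)
    (W : Submodule F (Fin (n + 1) → F)) : PlaneT → Prop
  | .T0 => TwoLineComb p c W ∧ wtRes c W = 0
  | .Tq1 => TwoLineComb p c W ∧ wtRes c W = q + 1
  | .T2q => TwoLineComb p c W ∧ wtRes c W = 2 * q
  | .T2q1 => TwoLineComb p c W ∧ wtRes c W = 2 * q + 1
  | .Todd => TypeOdd p c W
  | .Ttri => TypeTri p c W
  | .Tstar => TypeStar p c W

/-- The plane `W` is of type `𝒯`. -/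
def TypeT (p q : ℕ) [Fact p.Prime] [Fintype F] {n : ℕ} (c : Pt F n → ZMod p)
    (W : Submodule F (Fin (n + 1) → F)) : Prop :=
  IsPlane W ∧ ∃ t : PlaneT, PlaneIsType p q c W t

/-- The plane `W` is of type `𝒪`. -/
def TypeO (p q : ℕ) [Fact p.Prime] [Fintype F] {n : ℕ} (c : Pt F n → ZMod p)
    (W : Submodule F (Fin (n + 1) → F)) : Prop :=
  IsPlane W ∧ ¬ TypeT p q c W

/-- The restriction of `c` to the `k`-space `Sp` (linear dimension `k+1`) is of type `t`:
there is a `(k-3)`-space `κ ⊆ Sp` on which `c` is a scalar multiple of the all-one function,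
a plane `π ⊆ Sp` of type `t` disjoint from `κ`, and `c P = c (⟨κ, P⟩ ∩ π)` for every point
`P` of `Sp` outside `κ`. -/
def SpaceIsType (p q : ℕ) [Fact p.Prime] [Fintype F] {n : ℕ} (c : Pt F n → ZMod p)
    (Sp : Submodule F (Fin (n + 1) → F)) (k : ℕ) (t : PlaneT) : Prop :=
  Module.finrank F Sp = k + 1 ∧
  ∃ κ : Submodule F (Fin (n + 1) → F), Module.finrank F κ = k - 2 ∧ κ ≤ Sp ∧
    (∃ a : ZMod p, ∀ P : Pt F n, ptIn P κ → c P = a) ∧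
    ∃ π : Submodule F (Fin (n + 1) → F), IsPlane π ∧ π ≤ Sp ∧ π ⊓ κ = ⊥ ∧
      PlaneIsType p q c π t ∧
      ∀ P : Pt F n, ptIn P Sp → ¬ ptIn P κ →
        ∃ Q : Pt F n, ptIn Q π ∧
          Projectivization.submodule Q ≤ κ ⊔ Projectivization.submodule P ∧ c P = c Q


section

variable {p : ℕ} [Fact p.Prime]

lemma oddBase_mk (v : Fin 3 → ZMod p) (hv : v ≠ 0) :
    oddBase p (mk (ZMod p) v hv) =
      if v 0 = 0 ∧ v 1 ≠ 0 then v 2 / v 1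
      else if v 1 = 0 ∧ v 0 ≠ 0 then v 2 / v 0
      else if v 0 = v 1 ∧ v 0 ≠ 0 then -(v 2 / v 0)
      else 0 := by
  obtain ⟨a, ha⟩ := exists_smul_eq_mk_rep (ZMod p) v hv
  have ha' (i : Fin 3) : (mk (ZMod p) v hv).rep i = a * v i := by
    rw [← ha]; rfl
  simp [oddBase, ha', mul_div_mul_left]

lemma ptIn_mk_iff {F : Type} [Field F] {n : ℕ} (v : Fin (n + 1) → F) (hv : v ≠ 0)
    (W : Submodule F (Fin (n + 1) → F)) : ptIn (mk F v hv) W ↔ v ∈ W := by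
  rw [ptIn, submodule_mk, Submodule.span_singleton_le_iff_mem]

/-- The code word of the `T^odd` construction before a collineation is applied. -/
def oddWordBase (p : ℕ) [Fact p.Prime] (γ lam lam' lam'' : ZMod p) :
    Pt (ZMod p) 2 → ZMod p := fun P =>
  γ * oddBase p P + lam * incVec p (lineM1 p) P + lam' * incVec p (lineM2 p) P +
    lam'' * incVec p (lineM3 p) P

lemma oddWordBase_mk (γ lam lam' lam'' : ZMod p) (v : Fin 3 → ZMod p) (hv : v ≠ 0) :
    oddWordBase p γ lam lam' lam'' (mk (ZMod p) v hv) =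
      γ * (if v 0 = 0 ∧ v 1 ≠ 0 then v 2 / v 1
        else if v 1 = 0 ∧ v 0 ≠ 0 then v 2 / v 0
        else if v 0 = v 1 ∧ v 0 ≠ 0 then -(v 2 / v 0)
        else 0) + lam * (if v 0 = 0 then 1 else 0) + lam' * (if v 1 = 0 then 1 else 0) +
      lam'' * (if v 0 = v 1 then 1 else 0) := by
  simp only [oddWordBase, oddBase_mk, incVec, ptIn_mk_iff, lineM1, lineM2, lineM3,
    LinearMap.mem_ker, LinearMap.proj_apply, LinearMap.sub_apply, sub_eq_zero]

lemma wt_oddWord (g : (Fin 3 → ZMod p) ≃ₗ[ZMod p] (Fin 3 → ZMod p))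
    (γ lam lam' lam'' : ZMod p) :
    wt (oddWord p g γ lam lam' lam'') = wt (oddWordBase p γ lam lam' lam'') := by
  have hsurj : Function.Surjective (Projectivization.map g.toLinearMap g.injective) := by
    intro P
    induction P using Projectivization.ind with
    | h v hv =>
      refine ⟨mk (ZMod p) (g.symm v) (by simpa using hv), ?_⟩
      simp [map_mk]
  have hpre : supp (oddWord p g γ lam lam' lam'') =
      Projectivization.map g.toLinearMap g.injective ⁻¹'
        supp (oddWordBase p γ lam lam' lam'') := rfl
  rw [wt, wt, hpre, Set.ncard_preimage_of_injective_subset_range (map_injective _ _)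
    (by simp [hsurj.range_eq])]

/-- A representative of the point with parameter `a` on the `i`-th of the lines `m`, `m'`, `m''`. -/
def linePtVec (i : Fin 3) (a : ZMod p) : Fin 3 → ZMod p :=
  ![![0, 1, 1] i, ![1, 0, 1] i, a]

lemma linePtVec_ne_zero (i : Fin 3) (a : ZMod p) : linePtVec i a ≠ 0 := by
  intro h
  have h0 := congrFun h 0
  have h1 := congrFun h 1
  fin_cases i <;> simp [linePtVec] at h0 h1

/-- The points other than the common point `S` on the lines `m`, `m'`, `m''`. -/
def linePt (x : Fin 3 × ZMod p) : Pt (ZMod p) 2 :=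
  mk (ZMod p) (linePtVec x.1 x.2) (linePtVec_ne_zero x.1 x.2)

/-- The common point `(0, 0, 1)` of the lines `m`, `m'`, `m''`. -/
def vertex (p : ℕ) [Fact p.Prime] : Pt (ZMod p) 2 :=
  mk (ZMod p) ![0, 0, 1] (fun h => one_ne_zero (congrFun h 2))

lemma linePt_injective : Function.Injective (linePt (p := p)) := by
  rintro ⟨i, a⟩ ⟨j, b⟩ h
  obtain ⟨c, hc⟩ := (mk_eq_mk_iff' _ _ _ _ _).1 h
  have h0 := congrFun hc 0
  have h1 := congrFun hc 1
  have h2 := congrFun hc 2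
  fin_cases i <;> fin_cases j <;> simp_all [linePtVec]

lemma linePt_ne_vertex (x : Fin 3 × ZMod p) : linePt x ≠ vertex p := by
  obtain ⟨i, a⟩ := x
  intro h
  obtain ⟨c, hc⟩ := (mk_eq_mk_iff' _ _ _ _ _).1 h
  have h0 := congrFun hc 0
  have h1 := congrFun hc 1
  fin_cases i <;> simp [linePtVec] at h0 h1

lemma oddWordBase_linePt (γ lam lam' lam'' : ZMod p) (i : Fin 3) (a : ZMod p) :
    oddWordBase p γ lam lam' lam'' (linePt (i, a)) =
      ![1, 1, -1] i * (γ * a) + ![lam, lam', lam''] i := by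
  rw [linePt, oddWordBase_mk]
  fin_cases i <;> simp [linePtVec]

lemma mem_range_linePt {γ lam lam' lam'' : ZMod p} {P : Pt (ZMod p) 2}
    (hP : oddWordBase p γ lam lam' lam'' P ≠ 0) (hS : P ≠ vertex p) :
    P ∈ Set.range (linePt (p := p)) := by
  induction P using Projectivization.ind with
  | h v hv =>
    have key (i : Fin 3) (c : ZMod p) (hc : c ≠ 0) (h0 : v 0 = c * ![0, 1, 1] i)
        (h1 : v 1 = c * ![1, 0, 1] i) : mk (ZMod p) v hv ∈ Set.range (linePt (p := p)) := by
      refine ⟨(i, v 2 / c), (mk_eq_mk_iff' _ _ _ _ _).2 ⟨c⁻¹, ?_⟩⟩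
      funext j
      fin_cases j <;> simp [linePtVec, h0, h1, hc, div_eq_inv_mul]
    by_cases h0 : v 0 = 0
    · by_cases h1 : v 1 = 0
      · refine absurd ((mk_eq_mk_iff' _ _ _ _ _).2 ⟨v 2, ?_⟩) hS
        funext j
        fin_cases j <;> simp [h0, h1]
      · exact key 0 (v 1) h1 (by simp [h0]) (by simp)
    · by_cases h1 : v 1 = 0
      · exact key 1 (v 0) h0 (by simp) (by simp [h1])
      · by_cases h01 : v 0 = v 1
        · exact key 2 (v 0) h0 (by simp) (by simp [h01])
        · simp [oddWordBase_mk, h0, h1, h01] at hP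

lemma supp_oddWordBase_diff (γ lam lam' lam'' : ZMod p) :
    supp (oddWordBase p γ lam lam' lam'') \ {vertex p} =
      linePt '' {x | ![1, 1, -1] x.1 * (γ * x.2) + ![lam, lam', lam''] x.1 ≠ 0} := by
  ext P
  constructor
  · rintro ⟨hP, hS⟩
    obtain ⟨⟨i, a⟩, rfl⟩ := mem_range_linePt hP hS
    exact ⟨(i, a), by simpa only [supp, Set.mem_ofPred_eq, oddWordBase_linePt] using hP, rfl⟩
  · rintro ⟨⟨i, a⟩, hx, rfl⟩
    exact ⟨by simpa only [supp, Set.mem_ofPred_eq, oddWordBase_linePt] using hx,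
      linePt_ne_vertex _⟩

/-- A family of nonconstant affine functions on `ZMod p` has one zero per member. -/
lemma ncard_affine_ne_zero {ι : Type*} [Fintype ι] (s t : ι → ZMod p) (hs : ∀ i, s i ≠ 0) :
    {x : ι × ZMod p | s x.1 * x.2 + t x.1 ≠ 0}.ncard = Fintype.card ι * (p - 1) := by
  have hcompl : {x : ι × ZMod p | s x.1 * x.2 + t x.1 ≠ 0} =
      (Set.range fun i => (i, -t i / s i))ᶜ := by
    ext ⟨i, a⟩
    simp only [Set.mem_ofPred_eq, Set.mem_compl_iff, Set.mem_range, Prod.mk.injEq,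
      exists_eq_left, ne_eq, not_iff_not]
    rw [div_eq_iff (hs i), add_eq_zero_iff_eq_neg, mul_comm, eq_comm]
  have hinj : Function.Injective fun i => (i, -t i / s i) := fun i j h => (Prod.mk.inj h).1
  rw [hcompl, Set.ncard_compl, Set.ncard_range_of_injective hinj]
  simp [ZMod.card, Nat.mul_sub]

lemma ncard_supp_oddWordBase_diff {γ : ZMod p} (hγ : γ ≠ 0) (lam lam' lam'' : ZMod p) :
    (supp (oddWordBase p γ lam lam' lam'') \ {vertex p}).ncard = 3 * (p - 1) := by
  rw [supp_oddWordBase_diff, Set.ncard_image_of_injective _ linePt_injective]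
  have hs (i : Fin 3) : ![1, 1, -1] i * γ ≠ 0 := by fin_cases i <;> simpa using hγ
  simpa [mul_assoc] using ncard_affine_ne_zero _ ![lam, lam', lam''] hs

lemma eq_vertex_of_ptIn {P : Pt (ZMod p) 2} (hP : ptIn P (lineM1 p ⊓ lineM2 p ⊓ lineM3 p)) :
    P = vertex p := by
  induction P using Projectivization.ind with
  | h v hv =>
    rw [ptIn_mk_iff] at hP
    obtain ⟨⟨h0, h1⟩, -⟩ := hP
    replace h0 : v 0 = 0 := h0
    replace h1 : v 1 = 0 := h1
    refine (mk_eq_mk_iff' _ _ _ _ _).2 ⟨v 2, ?_⟩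
    funext j
    fin_cases j <;> simp [h0, h1]

end

/-- Proposition 5 of the paper: the `T^odd` code word
`d = (γc₀ + λm + λ'm' + λ''m'')^π` has weight `3p-3` if `d(S) = 0` and weight `3p-2` if
`d(S) ≠ 0`, where `S = (m ∩ m' ∩ m'')^π`. -/
theorem statement19 {p : ℕ} [Fact p.Prime] (hp2 : p ≠ 2)
    (g : (Fin 3 → ZMod p) ≃ₗ[ZMod p] (Fin 3 → ZMod p))
    (γ lam lam' lam'' : ZMod p) (hγ : γ ≠ 0)
    (S : Pt (ZMod p) 2)
    (hS : ptIn (Projectivization.map g.toLinearMap g.injective S)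
      (lineM1 p ⊓ lineM2 p ⊓ lineM3 p)) :
    (oddWord p g γ lam lam' lam'' S = 0 → wt (oddWord p g γ lam lam' lam'') = 3 * p - 3) ∧
    (oddWord p g γ lam lam' lam'' S ≠ 0 → wt (oddWord p g γ lam lam' lam'') = 3 * p - 2) := by
  have hp := (Fact.out : p.Prime).two_le
  have hval : oddWord p g γ lam lam' lam'' S =
      oddWordBase p γ lam lam' lam'' (vertex p) := by
    rw [← eq_vertex_of_ptIn hS]
    rfl
  have hcard := ncard_supp_oddWordBase_diff hγ lam lam' lam''
  rw [wt_oddWord, hval, wt]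
  refine ⟨fun h => ?_, fun h => ?_⟩
  · rw [Set.sdiff_singleton_eq_self (by simpa [supp] using h)] at hcard
    omega
  · have := Set.ncard_sdiff_singleton_add_one
      (show vertex p ∈ supp (oddWordBase p γ lam lam' lam'') from h)
    omega

end PGCode
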